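/- arXiv:1302.4268 — 3 statements merged into one kernel-verified Lean document; each statement's English description precedes it below -/
import Mathlib

section
/- Let q be a prime power, n = q − 1, α ∈ F_q a primitive element, k ≤ n, d = n − k + 1, and p ∈ ℕ with p ≥ 1, p ∣ n, and p ≥ d − 1. Let c ∈ RS(F_q; n, k) be a codeword, e ∈ F_q^n an error vector of Hamming weight wt(e) = ε, and r = c + e. Then PER_p(r) = c′ + e, where c′ := c + PER_p(r) − r satisfies c′ ∈ RS(F_q; n, k) and wt(c′) ≤ p + ε. -/
open Finset

/-- The Discrete Fourier Transform: `(dft n α v) j = ∑ i, v i * α ^ (j * i)`. -/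
def dft {F : Type*} [Field F] (n : ℕ) (α : F) (v : Fin n → F) : Fin n → F :=
  fun j => ∑ i : Fin n, v i * α ^ (j.val * i.val)

/-- The Inverse Discrete Fourier Transform:
`(idft n α V) j = n⁻¹ * ∑ i, V i * α ^ (-(j * i))`. -/
def idft {F : Type*} [Field F] (n : ℕ) (α : F) (V : Fin n → F) : Fin n → F :=
  fun j => (n : F)⁻¹ * ∑ i : Fin n, V i * (α ^ (j.val * i.val))⁻¹

/-- The primitive Reed--Solomon code of length `n` and dimension `k`: the set of
IDFTs of frequency-domain vectors whose last `n - k` components vanish. -/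
def RSCode {F : Type*} [Field F] (n k : ℕ) (α : F) : Set (Fin n → F) :=
  { c | ∃ C : Fin n → F, (∀ j : Fin n, k ≤ j.val → C j = 0) ∧ c = idft n α C }

/-- The periodicity projection `PER_p` : it maps `v` to the IDFT of the `p`-periodic
frequency-domain vector `(T, …, T)` (`n/p` copies) whose template vector
`T = (V_{n-p}, …, V_{n-1})` consists of the last `p` components of `V = DFT(v)`. -/
def per {F : Type*} [Field F] (n p : ℕ) (hp : 0 < p) (hpn : p ∣ n) (α : F)
    (v : Fin n → F) : Fin n → F :=
  idft n α fun j =>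
    dft n α v ⟨n - p + j.val % p, by
      have h0 := j.isLt
      have h1 := Nat.mod_lt j.val hp
      have h2 := Nat.le_of_dvd (by omega) hpn
      omega⟩

theorem geom_sum_eq_zero_of_pow_eq_one {F : Type*} [Field F] {x : F} {n : ℕ}
    (hx : x ^ n = 1) (hx1 : x ≠ 1) : ∑ i : Fin n, x ^ i.val = 0 := by
  rw [Fin.sum_univ_eq_sum_range (fun i => x ^ i) n, geom_sum_eq hx1, hx, sub_self, zero_div]

theorem idft_dft {F : Type*} [Field F] {n : ℕ} {α : F} (hα : orderOf α = n)
    (hn : (n : F) ≠ 0) (v : Fin n → F) : idft n α (dft n α v) = v := by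
  have hn0 : 0 < n := Nat.pos_of_ne_zero fun h => hn (by simp [h])
  have hα1 : α ^ n = 1 := hα ▸ pow_orderOf_eq_one α
  have hα0 : α ≠ 0 := by
    rintro rfl
    simp [hn0.ne'] at hα1
  ext j
  have inner (l : Fin n) :
      ∑ i : Fin n, (α ^ l.val * (α ^ j.val)⁻¹) ^ i.val = if l = j then (n : F) else 0 := by
    split_ifs with h
    · subst h
      simp [hα0]
    · refine geom_sum_eq_zero_of_pow_eq_one ?_ fun h1 => h ?_
      · rw [mul_pow, inv_pow, ← pow_mul, ← pow_mul, mul_comm l.val, mul_comm j.val, pow_mul,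
          pow_mul, hα1]
        simp
      · have h2 : α ^ l.val = α ^ j.val := by
          rwa [mul_inv_eq_one₀ (pow_ne_zero _ hα0)] at h1
        exact Fin.ext (pow_injOn_Iio_orderOf (by simp [hα]) (by simp [hα]) h2)
  have swap : ∑ i : Fin n, dft n α v i * (α ^ (j.val * i.val))⁻¹ =
      ∑ l : Fin n, v l * ∑ i : Fin n, (α ^ l.val * (α ^ j.val)⁻¹) ^ i.val := by
    simp only [dft, Finset.sum_mul, Finset.mul_sum]
    rw [Finset.sum_comm]
    refine Finset.sum_congr rfl fun l _ => Finset.sum_congr rfl fun i _ => ?_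
    rw [mul_pow, inv_pow, ← pow_mul, ← pow_mul, mul_comm i.val l.val, mul_assoc]
  simp only [idft, swap, inner]
  simp [mul_comm (v j), hn]

theorem idft_add {F : Type*} [Field F] (n : ℕ) (α : F) (V W : Fin n → F) :
    idft n α (V + W) = idft n α V + idft n α W := by
  ext j
  simp [idft, add_mul, Finset.sum_add_distrib, mul_add]

theorem idft_sub {F : Type*} [Field F] (n : ℕ) (α : F) (V W : Fin n → F) :
    idft n α (V - W) = idft n α V - idft n α W := by
  ext j
  simp [idft, sub_mul, Finset.sum_sub_distrib, mul_sub]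

/-- A periodic frequency vector has an inverse transform supported on the indices `j` with
`α ^ (j * p) = 1`. -/
theorem idft_periodic_eq_zero {F : Type*} [Field F] {n p : ℕ} (hpn : p ∣ n) {α : F}
    (hα : α ^ n = 1) (f : ℕ → F) (j : Fin n) (hj : α ^ (j.val * p) ≠ 1) :
    idft n α (fun i => f (i.val % p)) j = 0 := by
  obtain ⟨m, hm⟩ := hpn
  rw [mul_comm] at hm
  subst hm
  set β := (α ^ j.val)⁻¹ with hβ
  have hgeom : ∑ b : Fin m, (β ^ p) ^ b.val = 0 := by
    refine geom_sum_eq_zero_of_pow_eq_one ?_ fun h => hj ?_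
    · rw [← pow_mul, mul_comm p m, hβ, inv_pow, ← pow_mul, mul_comm, pow_mul, hα]
      simp
    · rw [hβ, inv_pow, ← pow_mul] at h
      exact inv_eq_one.mp h
  simp only [idft]
  rw [← finProdFinEquiv.sum_comp, Fintype.sum_prod_type_right]
  refine mul_eq_zero_of_right _ (Finset.sum_eq_zero fun a _ => ?_)
  calc _ = ∑ b : Fin m, f a.val * β ^ a.val * (β ^ p) ^ b.val := by
        refine Finset.sum_congr rfl fun b _ => ?_
        simp only [finProdFinEquiv_apply_val, Nat.add_mul_mod_self_left,
          Nat.mod_eq_of_lt a.isLt]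
        rw [pow_mul, ← inv_pow, ← hβ, pow_add, pow_mul, mul_assoc]
    _ = 0 := by rw [← Finset.mul_sum, hgeom, mul_zero]

theorem card_filter_dvd_mul_le {n p : ℕ} (hp : 0 < p) (hpn : p ∣ n) :
    #{j : Fin n | n ∣ j.val * p} ≤ p := by
  obtain ⟨m, rfl⟩ := hpn
  have hdvd (j : ℕ) (h : p * m ∣ j * p) : m ∣ j :=
    Nat.dvd_of_mul_dvd_mul_left hp (by rwa [mul_comm j p] at h)
  conv_rhs => rw [← Finset.card_range p]
  refine Finset.card_le_card_of_injOn (fun j => j.val / m) (fun j _ => ?_) fun i hi j hj h => ?_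
  · simpa using Nat.div_lt_of_lt_mul (j.isLt.trans_eq (mul_comm p m))
  · simp only [Finset.coe_filter, Finset.mem_univ, true_and, Set.mem_ofPred_eq] at hi hj
    refine Fin.ext ?_
    rw [← Nat.div_mul_cancel (hdvd _ hi), ← Nat.div_mul_cancel (hdvd _ hj)]
    exact congrArg (· * m) h

theorem sub_add_mod_lt {n p j : ℕ} (hp : 0 < p) (hpn : p ∣ n) (hj : j < n) :
    n - p + j % p < n := by
  have h1 := Nat.mod_lt j hp
  have h2 := Nat.le_of_dvd (Nat.zero_lt_of_lt hj) hpn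
  omega

theorem hammingNorm_per_le {F : Type*} [Field F] [DecidableEq F] {n p : ℕ} (hp : 0 < p)
    (hpn : p ∣ n) {α : F} (hα : orderOf α = n) (v : Fin n → F) :
    hammingNorm (per n p hp hpn α v) ≤ p := by
  refine (Finset.card_le_card fun j hj => ?_).trans (card_filter_dvd_mul_le hp hpn)
  simp only [Finset.mem_filter, Finset.mem_univ, true_and] at hj ⊢
  by_contra h
  refine hj ?_
  have h1 : α ^ (j.val * p) ≠ 1 := fun h2 =>
    h (hα.symm.dvd.trans (orderOf_dvd_of_pow_eq_one h2))
  have hα1 : α ^ n = 1 := orderOf_dvd_iff_pow_eq_one.mp hα.dvd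
  have h3 := idft_periodic_eq_zero hpn hα1
    (fun a => if ha : n - p + a < n then dft n α v ⟨n - p + a, ha⟩ else 0) j h1
  rw [← h3, per]
  congr 1
  ext i
  rw [dif_pos (sub_add_mod_lt hp hpn i.isLt)]

theorem sub_add_mod_of_le {n p j : ℕ} (hpn : p ∣ n) (hj : j < n) (h : n - p ≤ j) :
    n - p + j % p = j := by
  obtain ⟨t, ht⟩ := Nat.dvd_sub hpn (dvd_refl p)
  have hle := Nat.le_of_dvd (Nat.zero_lt_of_lt hj) hpn
  obtain ⟨a, rfl⟩ := Nat.exists_eq_add_of_le h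
  rw [ht, Nat.mul_add_mod, Nat.mod_eq_of_lt (by omega)]

/-- Let `n = q - 1`, `α` primitive in `F_q`, `k ≤ n`, `d = n - k + 1`, and `p ≥ 1` with
`p ∣ n` and `p ≥ d - 1`. If `c ∈ RS(F_q; n, k)`, `e` has Hamming weight `ε`, and
`r = c + e`, then `PER_p(r) = c' + e` where `c' = c + PER_p(r) - r` satisfies
`c' ∈ RS(F_q; n, k)` and `wt(c') ≤ p + ε`. -/
theorem statement_2 {F : Type*} [Field F] [Fintype F] [DecidableEq F]
    (n k : ℕ) (hn : n = Fintype.card F - 1)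
    (α : F) (hα : orderOf α = n) (hk : k ≤ n)
    (p : ℕ) (hp : 0 < p) (hpn : p ∣ n) (hpd : n - k ≤ p)
    (c : Fin n → F) (hc : c ∈ RSCode n k α)
    (e : Fin n → F) (ε : ℕ) (hε : hammingNorm e = ε)
    (r : Fin n → F) (hr : r = c + e) :
    per n p hp hpn α r = (c + per n p hp hpn α r - r) + e ∧
    (c + per n p hp hpn α r - r) ∈ RSCode n k α ∧
    hammingNorm (c + per n p hp hpn α r - r) ≤ p + ε := by
  have hnF : (n : F) ≠ 0 := by
    rw [hn, Nat.cast_sub Fintype.card_pos, Nat.cast_card_eq_zero]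
    simp
  refine ⟨by rw [hr]; abel, ?_, ?_⟩
  · obtain ⟨C, hC, rfl⟩ := hc
    refine ⟨C + (fun j => dft n α r ⟨n - p + j.val % p, sub_add_mod_lt hp hpn j.isLt⟩) - dft n α r,
      fun j hj => ?_, ?_⟩
    · have hfix : n - p + j.val % p = j.val := sub_add_mod_of_le hpn j.isLt (by omega)
      simp [hC j hj, hfix]
    · rw [idft_sub, idft_add, idft_dft hα hnF r]
      rfl
  · have h : c + per n p hp hpn α r - r = -e + per n p hp hpn α r := by
      rw [hr]
      abel
    rw [h, ← hammingDist_eq_hammingNorm, ← hε]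
    calc hammingDist e (per n p hp hpn α r)
        ≤ hammingDist e 0 + hammingDist 0 (per n p hp hpn α r) := hammingDist_triangle _ _ _
      _ ≤ p + hammingNorm e := by
        rw [hammingDist_zero_right, hammingDist_zero_left, add_comm]
        gcongr
        exact hammingNorm_per_le hp hpn hα r
end

section
/- Let q be a prime power, n = q − 1, α ∈ F_q a primitive element, s, ℓ ∈ ℕ with 1 ≤ s, and d_0, …, d_ℓ ∈ ℕ. Let J ⊆ {0, …, n−1} be a set of σ positions and r ∈ F_q^n a vector with r_j = 0 for all j ∈ J. Suppose Q(x, y) = Σ_{ν=0}^{ℓ} Q_ν(x) y^ν ∈ F_q[x][y] satisfies deg Q_ν ≤ d_ν for all ν and each point (α^{−j}, r_j), j = 0, …, n−1, is a zero of multiplicity at least s of Q. Then for every b with 0 ≤ b < s there exists W_b ∈ F_q[x] with deg W_b ≤ d_b − σ(s − b) such that Q_b(x) = W_b(x) · V(x)^{s−b}, where V(x) = ∏_{j ∈ J} (x − α^{−j}). -/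
open Finset Polynomial

/-- The evaluation at `(ξ, η)` of the `(a, b)`-th mixed Hasse derivative of a bivariate
polynomial `Q(x, y) = ∑_ν Q_ν(x) y^ν ∈ F[x][y]` (outer variable `y`), namely
`Q^{[a,b]}(ξ, η) = ∑_{ν ≥ b} ∑_{μ ≥ a} C(μ,a) C(ν,b) Q_{μ,ν} ξ^{μ-a} η^{ν-b}`
(the binomial coefficients vanish for `μ < a` or `ν < b`). -/
noncomputable def mixedHasseEval {F : Type*} [Field F] (Q : Polynomial (Polynomial F))
    (a b : ℕ) (ξ η : F) : F :=
  ∑ ν ∈ Q.support, ∑ μ ∈ (Q.coeff ν).support,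
    (μ.choose a : F) * (ν.choose b : F) * (Q.coeff ν).coeff μ * ξ ^ (μ - a) * η ^ (ν - b)

theorem mixedHasseEval_zero_right {F : Type*} [Field F] (Q : Polynomial (Polynomial F))
    (a b : ℕ) (ξ : F) :
    mixedHasseEval Q a b ξ 0 = (hasseDeriv a (Q.coeff b)).eval ξ := by
  have hderiv : (hasseDeriv a (Q.coeff b)).eval ξ =
      ∑ μ ∈ (Q.coeff b).support, (μ.choose a : F) * (Q.coeff b).coeff μ * ξ ^ (μ - a) := by
    simp [hasseDeriv_apply, sum_def, eval_finsetSum]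
  rw [hderiv, mixedHasseEval, Finset.sum_eq_single b]
  · simp
  · intro ν _ hν
    refine Finset.sum_eq_zero fun μ _ => ?_
    rcases lt_or_gt_of_ne hν with h | h
    · simp [Nat.choose_eq_zero_of_lt h]
    · simp [zero_pow (Nat.sub_ne_zero_of_lt h)]
  · intro hb
    simp [notMem_support_iff.mp hb]

theorem X_sub_C_pow_dvd_of_hasseDeriv_eval_eq_zero {R : Type*} [CommRing R] (f : R[X]) (ξ : R)
    (k : ℕ) (h : ∀ a < k, (hasseDeriv a f).eval ξ = 0) : (X - C ξ) ^ k ∣ f := by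
  rw [← map_dvd_iff (taylorEquiv ξ)]
  have hX : taylorEquiv ξ ((X - C ξ) ^ k) = X ^ k := by
    change taylor ξ ((X - C ξ) ^ k) = X ^ k
    simp
  rw [hX, X_pow_dvd_iff]
  intro a ha
  change (taylor ξ f).coeff a = 0
  rw [taylor_coeff, h a ha]

/-- Let `n = q - 1`, `α` primitive in `F_q`, `1 ≤ s ≤ ℓ + 1`, `d_0, …, d_ℓ ∈ ℕ`,
`J ⊆ {0, …, n-1}` a set of `σ` positions, and `r ∈ F_q^n` with `r j = 0` for `j ∈ J`.
If `Q(x,y) = ∑_{ν=0}^{ℓ} Q_ν(x) y^ν` satisfies `deg Q_ν ≤ d_ν` and each point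
`(α^{-j}, r_j)`, `j = 0, …, n-1`, is a zero of multiplicity at least `s` of `Q`, then
for every `b < s` there is `W_b` with `deg W_b ≤ d_b - σ(s - b)` such that
`Q_b(x) = W_b(x) · V(x)^{s-b}` where `V(x) = ∏_{j ∈ J} (x - α^{-j})`. -/
theorem statement_10 {F : Type*} [Field F] [Fintype F]
    (n : ℕ) (hn : n = Fintype.card F - 1)
    (α : F) (hα : orderOf α = n)
    (s ℓ : ℕ) (hs : 1 ≤ s) (hsℓ : s ≤ ℓ + 1)
    (d : Fin (ℓ + 1) → ℕ)
    (J : Finset (Fin n)) (σ : ℕ) (hσ : J.card = σ)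
    (r : Fin n → F) (hr : ∀ j ∈ J, r j = 0)
    (Q : Polynomial (Polynomial F)) (hQℓ : Q.natDegree ≤ ℓ)
    (hQd : ∀ ν : Fin (ℓ + 1), (Q.coeff ν.val).degree ≤ (d ν : WithBot ℕ))
    (hzero : ∀ j : Fin n, ∀ a b : ℕ, a + b < s →
      mixedHasseEval Q a b ((α ^ j.val)⁻¹) (r j) = 0) :
    ∀ (b : ℕ) (hb : b < s),
      ∃ W : Polynomial F,
        Q.coeff b =
          W * (∏ j ∈ J, (Polynomial.X - Polynomial.C ((α ^ j.val)⁻¹))) ^ (s - b) ∧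
        W.degree + ((σ * (s - b) : ℕ) : WithBot ℕ) ≤ (d ⟨b, by omega⟩ : WithBot ℕ) := by
  intro b hb
  have hinj : Function.Injective fun j : Fin n => (α ^ j.val)⁻¹ := fun i j hij =>
    Fin.ext (pow_injOn_Iio_orderOf (by simp [hα]) (by simp [hα]) (inv_injective hij))
  have hdvd : (∏ j ∈ J, (X - C ((α ^ j.val)⁻¹))) ^ (s - b) ∣ Q.coeff b := by
    rw [← Finset.prod_pow]
    refine Finset.prod_dvd_of_coprime
      (fun i _ j _ hij => (pairwise_coprime_X_sub_C hinj hij).pow) fun j hj => ?_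
    refine X_sub_C_pow_dvd_of_hasseDeriv_eval_eq_zero _ _ _ fun a ha => ?_
    rw [← mixedHasseEval_zero_right]
    simpa only [hr j hj] using hzero j a b (by omega)
  obtain ⟨W, hW⟩ := hdvd
  refine ⟨W, by rw [hW, mul_comm], ?_⟩
  have hdeg : ((∏ j ∈ J, (X - C ((α ^ j.val)⁻¹))) ^ (s - b)).degree =
      ((σ * (s - b) : ℕ) : WithBot ℕ) := by
    simp [degree_pow, degree_prod, hσ, mul_comm]
  calc W.degree + ((σ * (s - b) : ℕ) : WithBot ℕ) = (Q.coeff b).degree := by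
        rw [hW, degree_mul, hdeg, add_comm]
    _ ≤ _ := hQd ⟨b, by omega⟩
end

section
/- Let q be a prime power, n = q − 1, α ∈ F_q a primitive element, s, ℓ ∈ ℕ with 1 ≤ s, r ∈ F_q^n, and d_0, …, d_ℓ ∈ ℕ. If Σ_{ν=0}^{ℓ} (d_ν + 1) > n·s(s+1)/2, then there exists a nonzero bivariate polynomial Q(x, y) = Σ_{ν=0}^{ℓ} Q_ν(x) y^ν ∈ F_q[x][y] with deg Q_ν ≤ d_ν for all ν such that each point (α^{−j}, r_j), j = 0, …, n−1, is a zero of multiplicity at least s of Q. -/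
open Finset Polynomial

/-- The evaluated mixed Hasse derivative as an `F`-linear functional of the polynomial. -/
noncomputable def mixedHasseEvalLinear {F : Type*} [Field F] (a b : ℕ) (ξ η : F) :
    Polynomial (Polynomial F) →ₗ[F] F :=
  Polynomial.lsum fun ν => Polynomial.lsum fun μ =>
    LinearMap.mulLeft F ((μ.choose a : F) * (ν.choose b : F) * ξ ^ (μ - a) * η ^ (ν - b))

theorem mixedHasseEvalLinear_apply {F : Type*} [Field F] (a b : ℕ) (ξ η : F)
    (Q : Polynomial (Polynomial F)) :
    mixedHasseEvalLinear a b ξ η Q = mixedHasseEval Q a b ξ η := by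
  simp only [mixedHasseEvalLinear, mixedHasseEval, Polynomial.lsum_apply, Polynomial.sum_def,
    LinearMap.mulLeft_apply]
  refine Finset.sum_congr rfl fun ν _ => Finset.sum_congr rfl fun μ _ => ?_
  ring

/-- The bivariate polynomial `∑_ν p_ν(x) y^ν` with `deg p_ν < N_ν`, as a linear function of the
family `p`. -/
noncomputable def ofBoundedCoeffs {F : Type*} [Field F] {m : ℕ} (N : Fin m → ℕ) :
    ((ν : Fin m) → Polynomial.degreeLT F (N ν)) →ₗ[F] Polynomial (Polynomial F) :=
  ∑ ν : Fin m, ((Polynomial.monomial (R := Polynomial F) ν.val).restrictScalars F) ∘ₗ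
    (Polynomial.degreeLT F (N ν)).subtype ∘ₗ LinearMap.proj ν

theorem ofBoundedCoeffs_apply {F : Type*} [Field F] {m : ℕ} (N : Fin m → ℕ)
    (p : (ν : Fin m) → Polynomial.degreeLT F (N ν)) :
    ofBoundedCoeffs N p = ∑ ν : Fin m, Polynomial.monomial ν.val (p ν : Polynomial F) := by
  simp [ofBoundedCoeffs]

theorem coeff_ofBoundedCoeffs {F : Type*} [Field F] {m : ℕ} (N : Fin m → ℕ)
    (p : (ν : Fin m) → Polynomial.degreeLT F (N ν)) (ν : Fin m) :
    (ofBoundedCoeffs N p).coeff ν.val = p ν := by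
  simp [ofBoundedCoeffs_apply, Polynomial.finsetSum_coeff, Polynomial.coeff_monomial, Fin.val_inj]

theorem degree_ofBoundedCoeffs_lt {F : Type*} [Field F] {m : ℕ} (N : Fin m → ℕ)
    (p : (ν : Fin m) → Polynomial.degreeLT F (N ν)) :
    (ofBoundedCoeffs N p).degree < m := by
  rw [ofBoundedCoeffs_apply, ← Polynomial.mem_degreeLT]
  refine Submodule.sum_mem _ fun ν _ => Polynomial.mem_degreeLT.2 ?_
  exact (Polynomial.degree_monomial_le _ _).trans_lt (by exact_mod_cast ν.isLt)

theorem degree_le_of_degree_lt_succ {R : Type*} [Semiring R] {p : Polynomial R} {k : ℕ}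
    (h : p.degree < ((k + 1 : ℕ) : WithBot ℕ)) : p.degree ≤ k :=
  (Polynomial.degree_le_iff_coeff_zero p k).2 fun m hm =>
    (Polynomial.degree_lt_iff_coeff_zero p (k + 1)).1 h m
      (Nat.succ_le_of_lt (by exact_mod_cast hm))

theorem finrank_pi_degreeLT {F : Type*} [Field F] {m : ℕ} (N : Fin m → ℕ) :
    Module.finrank F ((ν : Fin m) → Polynomial.degreeLT F (N ν)) = ∑ ν, N ν := by
  rw [(LinearEquiv.piCongrRight fun ν => Polynomial.degreeLTEquiv F (N ν)).finrank_eq,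
    Module.finrank_pi_fintype]
  simp

theorem card_sigma_fin_succ (s : ℕ) :
    Fintype.card (Σ i : Fin s, Fin (i.val + 1)) = s * (s + 1) / 2 := by
  rw [Fintype.card_sigma]
  simp only [Fintype.card_fin]
  rw [Fin.sum_univ_eq_sum_range (fun i => i + 1) s]
  have h := Finset.sum_range_id (s + 1)
  rw [Finset.sum_range_succ'] at h
  simpa [mul_comm] using h

/-- Let `n = q - 1`, `α` primitive in `F_q`, `s ≥ 1`, `r ∈ F_q^n`, and
`d_0, …, d_ℓ ∈ ℕ`. If `∑_{ν=0}^{ℓ} (d_ν + 1) > n·s(s+1)/2`, then there exists a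
nonzero `Q(x,y) = ∑_{ν=0}^{ℓ} Q_ν(x) y^ν ∈ F_q[x][y]` with `deg Q_ν ≤ d_ν` for all
`ν` such that each point `(α^{-j}, r_j)`, `j = 0, …, n-1`, is a zero of multiplicity
at least `s` of `Q`. -/
theorem statement_13 {F : Type*} [Field F] [Fintype F]
    (n : ℕ) (hn : n = Fintype.card F - 1)
    (α : F) (hα : orderOf α = n)
    (s ℓ : ℕ) (hs : 1 ≤ s)
    (r : Fin n → F) (d : Fin (ℓ + 1) → ℕ)
    (hcount : n * (s * (s + 1) / 2) < ∑ ν : Fin (ℓ + 1), (d ν + 1)) :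
    ∃ Q : Polynomial (Polynomial F),
      Q ≠ 0 ∧ Q.natDegree ≤ ℓ ∧
      (∀ ν : Fin (ℓ + 1), (Q.coeff ν.val).degree ≤ (d ν : WithBot ℕ)) ∧
      ∀ j : Fin n, ∀ a b : ℕ, a + b < s →
        mixedHasseEval Q a b ((α ^ j.val)⁻¹) (r j) = 0 := by
  have : ∀ ν, FiniteDimensional F (Polynomial.degreeLT F (d ν + 1)) := fun ν =>
    (Polynomial.degreeLTEquiv F (d ν + 1)).symm.finiteDimensional
  let φ : ((ν : Fin (ℓ + 1)) → Polynomial.degreeLT F (d ν + 1)) →ₗ[F]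
      (Fin n × (Σ i : Fin s, Fin (i.val + 1)) → F) :=
    LinearMap.pi fun k => mixedHasseEvalLinear k.2.2.val (k.2.1.val - k.2.2.val)
      ((α ^ k.1.val)⁻¹) (r k.1) ∘ₗ ofBoundedCoeffs fun ν => d ν + 1
  have hφ : LinearMap.ker φ ≠ ⊥ := LinearMap.ker_ne_bot_of_finrank_lt <| by
    rwa [finrank_pi_degreeLT, Module.finrank_fintype_fun_eq_card, Fintype.card_prod,
      Fintype.card_fin, card_sigma_fin_succ]
  obtain ⟨p, hp, hp0⟩ := Submodule.exists_mem_ne_zero_of_ne_bot hφ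
  refine ⟨ofBoundedCoeffs (fun ν => d ν + 1) p, ?_, ?_, fun ν => ?_, fun j a b hab => ?_⟩
  · contrapose! hp0
    ext1 ν
    rw [Pi.zero_apply, ← Submodule.coe_eq_zero, ← coeff_ofBoundedCoeffs, hp0,
      Polynomial.coeff_zero]
  · exact Polynomial.natDegree_le_iff_degree_le.2
      (degree_le_of_degree_lt_succ (degree_ofBoundedCoeffs_lt _ p))
  · rw [coeff_ofBoundedCoeffs]
    exact degree_le_of_degree_lt_succ (Polynomial.mem_degreeLT.1 (p ν).2)
  · have h := congrFun (LinearMap.mem_ker.1 hp) (j, ⟨⟨a + b, hab⟩, ⟨a, by simp⟩⟩)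
    simpa [φ, mixedHasseEvalLinear_apply] using h
end
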